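/- Let (A,B,C) be a bipartite normalized LR triple on V of diameter d ≥ 4. Then the tridiagonal space 𝒳 of (A,B,C) has dimension at most 8. -/

import Mathlib

/-- A decomposition of `V` of diameter `d`: a sequence of one-dimensional subspaces
`sub 0, …, sub d` whose (direct) sum is `V`; by convention `sub i = ⊥` for `i > d`
(encoding `V_{-1} = 0` and `V_{d+1} = 0`). -/
structure LRDecomp (F : Type*) [Field F] (V : Type*) [AddCommGroup V] [Module F V]
    (d : ℕ) where
  sub : ℕ → Submodule F V
  finrank_eq_one : ∀ i ≤ d, Module.finrank F (sub i) = 1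
  eq_bot_of_gt : ∀ i, d < i → sub i = ⊥
  isInternal : DirectSum.IsInternal fun i : Fin (d + 1) => sub i.val

variable {F : Type*} [Field F] {V : Type*} [AddCommGroup V] [Module F V]

/-- `A` lowers the decomposition: `A V_i = V_{i-1}` for `0 ≤ i ≤ d` (with `V_{-1} = 0`). -/
def Lowers {d : ℕ} (A : Module.End F V) (D : LRDecomp F V d) : Prop :=
  Submodule.map A (D.sub 0) = ⊥ ∧ ∀ i < d, Submodule.map A (D.sub (i + 1)) = D.sub i

/-- `B` raises the decomposition: `B V_i = V_{i+1}` for `0 ≤ i ≤ d` (with `V_{d+1} = 0`). -/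
def Raises {d : ℕ} (B : Module.End F V) (D : LRDecomp F V d) : Prop :=
  ∀ i ≤ d, Submodule.map B (D.sub i) = D.sub (i + 1)

/-- `D` is the (A,B)-decomposition: it is lowered by `A` and raised by `B`. -/
def IsLRPairWith {d : ℕ} (A B : Module.End F V) (D : LRDecomp F V d) : Prop :=
  Lowers A D ∧ Raises B D

/-- `(A,B,C)` is an LR triple of diameter `d`. -/
def IsLRTriple (d : ℕ) (A B C : Module.End F V) : Prop :=
  (∃ D : LRDecomp F V d, IsLRPairWith A B D) ∧
  (∃ D : LRDecomp F V d, IsLRPairWith B C D) ∧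
  (∃ D : LRDecomp F V d, IsLRPairWith C A D)

/-- `X` is tridiagonal with respect to the decomposition `D`:
`X V_i ⊆ V_{i-1} + V_i + V_{i+1}` (note `V_{0-1} ⊔ V_0 = V_0` makes `ℕ`-subtraction correct). -/
def IsTridiagonal {d : ℕ} (X : Module.End F V) (D : LRDecomp F V d) : Prop :=
  ∀ i, ∀ v ∈ D.sub i, X v ∈ D.sub (i - 1) ⊔ D.sub i ⊔ D.sub (i + 1)

/-- The tridiagonal space of the LR triple with decompositions `D₁, D₂, D₃`. -/
def tridiagSpace {d : ℕ} (D₁ D₂ D₃ : LRDecomp F V d) : Submodule F (Module.End F V) where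
  carrier := {X | IsTridiagonal X D₁ ∧ IsTridiagonal X D₂ ∧ IsTridiagonal X D₃}
  add_mem' := by
    rintro X Y ⟨hX1, hX2, hX3⟩ ⟨hY1, hY2, hY3⟩
    exact ⟨fun i v hv => by simpa using add_mem (hX1 i v hv) (hY1 i v hv),
           fun i v hv => by simpa using add_mem (hX2 i v hv) (hY2 i v hv),
           fun i v hv => by simpa using add_mem (hX3 i v hv) (hY3 i v hv)⟩
  zero_mem' :=
    ⟨fun i v _ => by simp,
     fun i v _ => by simp,
     fun i v _ => by simp⟩
  smul_mem' := by
    rintro c X ⟨hX1, hX2, hX3⟩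
    exact ⟨fun i v hv => by simpa using Submodule.smul_mem _ c (hX1 i v hv),
           fun i v hv => by simpa using Submodule.smul_mem _ c (hX2 i v hv),
           fun i v hv => by simpa using Submodule.smul_mem _ c (hX3 i v hv)⟩

/-- `E` is the idempotent sequence of the decomposition `D`: each `E i` acts as the
identity on `sub i` and as zero on `sub j` for `j ≠ i`. -/
def IsIdemSeq {d : ℕ} (D : LRDecomp F V d) (E : ℕ → Module.End F V) : Prop :=
  ∀ i, (∀ v ∈ D.sub i, E i v = v) ∧ ∀ j, j ≠ i → ∀ v ∈ D.sub j, E i v = 0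

/-- Bipartite: all trace data `a_i = tr(C E_i)`, `a'_i = tr(A E'_i)`, `a''_i = tr(B E''_i)`
vanish, where `E, E', E''` are the idempotent data of the triple `(A,B,C)`. -/
def IsBipartite (d : ℕ) (A B C : Module.End F V)
    (E E' E'' : ℕ → Module.End F V) : Prop :=
  ∀ i ≤ d, LinearMap.trace F V (C * E i) = 0 ∧
    LinearMap.trace F V (A * E' i) = 0 ∧ LinearMap.trace F V (B * E'' i) = 0

/-- An LR pair `(A,B)` has `q`-Weyl type. -/
def IsQWeylPair (q : F) (A B : Module.End F V) : Prop :=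
  q ≠ 0 ∧ q ^ 2 ≠ 1 ∧ q • (A * B) - q⁻¹ • (B * A) = (q - q⁻¹) • (1 : Module.End F V)

/-- An LR triple `(A,B,C)` has `q`-Weyl type. -/
def IsQWeylTriple (q : F) (A B C : Module.End F V) : Prop :=
  IsQWeylPair q A B ∧ IsQWeylPair q B C ∧ IsQWeylPair q C A

/-- `v` is an `(A,B)`-basis, relative to the `(A,B)`-decomposition `D`:
`v i ∈ sub i` is nonzero and `A v_i = v_{i-1}`. -/
def IsLRBasisFor {d : ℕ} (A : Module.End F V) (D : LRDecomp F V d) (v : ℕ → V) : Prop :=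
  (∀ i ≤ d, v i ∈ D.sub i ∧ v i ≠ 0) ∧ ∀ i, 1 ≤ i → i ≤ d → A (v i) = v (i - 1)

/-- `v` is a `(B,A)`-style basis relative to the `(A,B)`-decomposition `D` of the
reversed pair: `v i ∈ sub (d-i)` is nonzero and the lowering map sends `v i ↦ v (i-1)`.
(Used for `(C,B)`-bases relative to the `(B,C)`-decomposition, etc.) -/
def IsLRBasisRev {d : ℕ} (A : Module.End F V) (D : LRDecomp F V d) (v : ℕ → V) : Prop :=
  (∀ i ≤ d, v i ∈ D.sub (d - i) ∧ v i ≠ 0) ∧ ∀ i, 1 ≤ i → i ≤ d → A (v i) = v (i - 1)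

/-- The transition matrix from the basis `u` to the basis `w` is upper triangular
Toeplitz with parameters `α`: `w j = ∑_{i ≤ j} α_{j-i} u_i`. -/
def IsToeplitzTransition (d : ℕ) (u w : ℕ → V) (α : ℕ → F) : Prop :=
  ∀ j ≤ d, w j = ∑ i ∈ Finset.range (j + 1), α (j - i) • u i

/-- `φ` is the parameter sequence of the LR pair `(A,B)` with `(A,B)`-decomposition `D`:
`BA` acts on `V_i` as `φ i` for `1 ≤ i ≤ d`, with conventions `φ 0 = 0 = φ (d+1)`. -/
def IsParamSeq {d : ℕ} (A B : Module.End F V) (D : LRDecomp F V d) (φ : ℕ → F) : Prop :=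
  φ 0 = 0 ∧ φ (d + 1) = 0 ∧ ∀ i, 1 ≤ i → i ≤ d → ∀ v ∈ D.sub i, B (A v) = φ i • v


/-- `c` is the family of coordinate functionals of a basis `v` adapted to the decomposition `D`,
where `v i` lies in the component with index `σ i`. -/
structure IsDualFamily {d : ℕ} (D : LRDecomp F V d) (σ : ℕ → ℕ) (v : ℕ → V)
    (c : ℕ → V →ₗ[F] F) : Prop where
  mem : ∀ i ≤ d, v i ∈ D.sub (σ i)
  ne_zero : ∀ i ≤ d, v i ≠ 0
  coord_self : ∀ i ≤ d, c i (v i) = 1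
  coord_of_mem : ∀ i m, m ≠ σ i → ∀ x ∈ D.sub m, c i x = 0
  coord_of_gt : ∀ i, d < i → c i = 0
  sum_coord : ∀ x, ∑ i ∈ Finset.range (d + 1), c i x • v i = x

theorem LRDecomp.exists_smul_eq {d : ℕ} (D : LRDecomp F V d) {i : ℕ} {v : V}
    (hv : v ∈ D.sub i) (hv0 : v ≠ 0) {x : V} (hx : x ∈ D.sub i) : ∃ t : F, x = t • v := by
  rcases le_or_gt i d with hi | hi
  · obtain ⟨t, ht⟩ := (finrank_eq_one_iff_of_nonzero' (⟨v, hv⟩ : D.sub i)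
      (by simpa [Subtype.ext_iff] using hv0)).1 (D.finrank_eq_one i hi) ⟨x, hx⟩
    exact ⟨t, by simpa using (congrArg Subtype.val ht).symm⟩
  · rw [D.eq_bot_of_gt i hi, Submodule.mem_bot] at hv
    exact absurd hv hv0

theorem exists_isDualFamily [FiniteDimensional F V] {d : ℕ}
    (hdim : Module.finrank F V = d + 1) (D : LRDecomp F V d) (σ : ℕ → ℕ)
    (hσ : ∀ i ≤ d, σ i ≤ d) (hσσ : ∀ i ≤ d, σ (σ i) = i) (v : ℕ → V)
    (hv : ∀ i ≤ d, v i ∈ D.sub (σ i) ∧ v i ≠ 0) :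
    ∃ c, IsDualFamily D σ v c := by
  have hind := D.isInternal.submodule_iSupIndep
  let τ : Fin (d + 1) → Fin (d + 1) := fun i =>
    ⟨σ i, Nat.lt_succ_of_le (hσ i (Nat.le_of_lt_succ i.2))⟩
  have hτ : Function.Injective τ := by
    intro i j hij
    have h : σ i = σ j := congrArg Fin.val hij
    have h' := congrArg σ h
    rw [hσσ _ (Nat.le_of_lt_succ i.2), hσσ _ (Nat.le_of_lt_succ j.2)] at h'
    exact Fin.ext h'
  have hli : LinearIndependent F (fun i : Fin (d + 1) => v i) :=
    iSupIndep.linearIndependent _ (hind.comp hτ)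
      (fun i => (hv i (Nat.le_of_lt_succ i.2)).1) (fun i => (hv i (Nat.le_of_lt_succ i.2)).2)
  let b := basisOfLinearIndependentOfCardEqFinrank hli (by simp [hdim])
  have hb : ∀ i, b i = v i := fun i => by simp [b]
  have hself : ∀ i (hi : i < d + 1), b.coord ⟨i, hi⟩ (v i) = 1 := fun i hi => by
    rw [← hb ⟨i, hi⟩]; simp
  have hne : ∀ i (hi : i < d + 1) j, j ≤ d → j ≠ i → b.coord ⟨i, hi⟩ (v j) = 0 :=
    fun i hi j hj hji => by
      have := hb ⟨j, Nat.lt_succ_of_le hj⟩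
      simp only at this
      rw [← this, Module.Basis.coord_apply, Module.Basis.repr_self, Finsupp.single_apply, if_neg]
      simpa [Fin.ext_iff] using hji
  refine ⟨fun i => if h : i < d + 1 then b.coord ⟨i, h⟩ else 0, fun i hi => (hv i hi).1,
    fun i hi => (hv i hi).2, fun i hi => ?_, fun i m hm x hx => ?_, fun i hi => ?_, fun x => ?_⟩
  · rw [dif_pos (Nat.lt_succ_of_le hi)]
    exact hself _ _
  · split_ifs with hi
    · rcases le_or_gt m d with hmd | hmd
      · have h1 := hv (σ m) (hσ m hmd)
        rw [hσσ m hmd] at h1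
        obtain ⟨t, rfl⟩ := D.exists_smul_eq h1.1 h1.2 hx
        rw [map_smul, hne i hi _ (hσ m hmd), smul_zero]
        rintro rfl
        exact hm (hσσ m hmd).symm
      · rw [D.eq_bot_of_gt m hmd, Submodule.mem_bot] at hx
        simp [hx]
    · rfl
  · rw [dif_neg (by omega)]
  · rw [Finset.sum_range]
    conv_rhs => rw [← b.sum_repr x]
    refine Finset.sum_congr rfl fun i _ => ?_
    rw [dif_pos i.2, hb, Module.Basis.coord_apply]

namespace IsDualFamily

variable {d : ℕ} {D : LRDecomp F V d} {σ : ℕ → ℕ} {v : ℕ → V} {c : ℕ → V →ₗ[F] F}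

theorem coord_sum (h : IsDualFamily D σ v c) (f : V →ₗ[F] F) (x : V) :
    f x = ∑ i ∈ Finset.range (d + 1), f (v i) * c i x := by
  conv_lhs => rw [← h.sum_coord x]
  simp [mul_comm]

theorem eq_zero (h : IsDualFamily D σ v c) {x : V} (hx : ∀ i ≤ d, c i x = 0) : x = 0 := by
  rw [← h.sum_coord x]
  exact Finset.sum_eq_zero fun i hi => by
    rw [hx i (Nat.le_of_lt_succ (Finset.mem_range.1 hi)), zero_smul]

theorem ext_end (h : IsDualFamily D σ v c) {X : Module.End F V} (hX : ∀ i ≤ d, X (v i) = 0) :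
    X = 0 := by
  ext x
  rw [← h.sum_coord x]
  simp only [map_sum, map_smul, LinearMap.zero_apply, smul_zero, Finset.sum_const_zero]
  exact Finset.sum_eq_zero fun i hi => by
    rw [hX i (Nat.le_of_lt_succ (Finset.mem_range.1 hi)), smul_zero]

theorem coord_ne_zero (h : IsDualFamily D σ v c) {i : ℕ} (hi : i ≤ d) {x : V}
    (hx : x ∈ D.sub (σ i)) (hx0 : x ≠ 0) : c i x ≠ 0 := by
  obtain ⟨t, rfl⟩ := D.exists_smul_eq (h.mem i hi) (h.ne_zero i hi) hx
  rw [map_smul, h.coord_self i hi]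
  simpa using (smul_ne_zero_iff.1 hx0).1

theorem coord_eq_zero_of_tridiagonal (h : IsDualFamily D σ v c) {X : Module.End F V}
    (hX : IsTridiagonal X D) {j k : ℕ} (hj : j ≤ d) (h1 : σ k ≠ σ j - 1) (h2 : σ k ≠ σ j)
    (h3 : σ k ≠ σ j + 1) : c k (X (v j)) = 0 := by
  have : D.sub (σ j - 1) ⊔ D.sub (σ j) ⊔ D.sub (σ j + 1) ≤ LinearMap.ker (c k) :=
    sup_le (sup_le (fun x hx => h.coord_of_mem k _ h1.symm x hx)
      (fun x hx => h.coord_of_mem k _ h2.symm x hx))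
      (fun x hx => h.coord_of_mem k _ h3.symm x hx)
  exact this (hX _ _ (h.mem j hj))

theorem isTridiagonal (h : IsDualFamily D id v c) {X : Module.End F V}
    (hX : ∀ j ≤ d, ∀ k, k + 1 < j ∨ j + 1 < k → c k (X (v j)) = 0) : IsTridiagonal X D := by
  intro j x hx
  rcases le_or_gt j d with hj | hj
  · obtain ⟨t, rfl⟩ := D.exists_smul_eq (h.mem j hj) (h.ne_zero j hj) hx
    rw [map_smul]
    refine Submodule.smul_mem _ _ ?_
    rw [← h.sum_coord (X (v j))]
    refine Submodule.sum_mem _ fun k hk => ?_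
    have hkd := Nat.le_of_lt_succ (Finset.mem_range.1 hk)
    by_cases hz : k + 1 < j ∨ j + 1 < k
    · rw [hX j hj k hz, zero_smul]
      exact zero_mem _
    · refine Submodule.smul_mem _ _ ?_
      have hmem : v k ∈ D.sub k := h.mem k hkd
      have hcases : k = j - 1 ∨ k = j ∨ k = j + 1 := by omega
      rcases hcases with e | e | e <;> rw [← e]
      · exact Submodule.mem_sup_left (Submodule.mem_sup_left hmem)
      · exact Submodule.mem_sup_left (Submodule.mem_sup_right hmem)
      · exact Submodule.mem_sup_right hmem
  · rw [D.eq_bot_of_gt j hj, Submodule.mem_bot] at hx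
    rw [hx, map_zero]
    exact zero_mem _

theorem trace_mul_idem [FiniteDimensional F V] (h : IsDualFamily D id v c)
    {E : ℕ → Module.End F V} (hE : IsIdemSeq D E) (C : Module.End F V) {i : ℕ} (hi : i ≤ d) :
    LinearMap.trace F V (C * E i) = c i (C (v i)) := by
  have hC : C * E i = (c i).smulRight (C (v i)) := by
    rw [← sub_eq_zero]
    refine h.ext_end fun j hj => ?_
    by_cases hij : j = i
    · subst hij
      simp [(hE j).1 _ (h.mem j hj), h.coord_self j hj]
    · simp [(hE i).2 j hij _ (h.mem j hj), h.coord_of_mem i j hij _ (h.mem j hj)]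
  rw [hC, LinearMap.trace_smulRight]

end IsDualFamily

theorem mem_iff_of_isToeplitzTransition {d : ℕ} {u w : ℕ → V} {α : ℕ → F}
    (hα : IsToeplitzTransition d u w α) (hα0 : α 0 = 1) {Q : ℕ → Submodule F V}
    (hQ : Monotone Q) : (∀ i ≤ d, u i ∈ Q i) ↔ ∀ i ≤ d, w i ∈ Q i := by
  constructor
  · intro hu j hj
    rw [hα j hj]
    refine Submodule.sum_mem _ fun i hi => Submodule.smul_mem _ _ ?_
    have hij := Nat.le_of_lt_succ (Finset.mem_range.1 hi)
    exact hQ hij (hu i (hij.trans hj))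
  · intro hw j
    induction j using Nat.strong_induction_on with
    | _ j ih =>
      intro hj
      have h := hα j hj
      rw [Finset.sum_range_succ, Nat.sub_self, hα0, one_smul] at h
      rw [← sub_eq_iff_eq_add'.2 h]
      refine Submodule.sub_mem _ (hw j hj)
        (Submodule.sum_mem _ fun i hi => Submodule.smul_mem _ _ ?_)
      have hij := Finset.mem_range.1 hi
      exact hQ hij.le (ih i hij (hij.le.trans hj))

theorem toeplitz_zero_eq_one {d : ℕ} {u w : ℕ → V} {α : ℕ → F}
    (hα : IsToeplitzTransition d u w α) (h0 : u 0 = w 0) (hne : u 0 ≠ 0) : α 0 = 1 := by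
  have h := hα 0 (Nat.zero_le _)
  rw [Finset.sum_range_one, ← h0, Nat.sub_zero] at h
  have h' : (α 0 - 1) • u 0 = 0 := by rw [sub_smul, one_smul, ← h, sub_self]
  exact sub_eq_zero.1 ((smul_eq_zero.1 h').resolve_right hne)

/-- If `C` shifts a flag-adapted family `q` by one step, it shifts by one step every
flag that is adapted to `q`. -/
theorem apply_mem_of_shift {d : ℕ} {p q : ℕ → V} {C : Module.End F V} {Q : ℕ → Submodule F V}
    (hQ : Monotone Q)
    (hpq : ∀ P : ℕ → Submodule F V, Monotone P →
      ((∀ i ≤ d, p i ∈ P i) ↔ ∀ i ≤ d, q i ∈ P i))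
    (hp : ∀ i ≤ d, p i ∈ Q i) (hC : ∀ i < d, ∃ t : F, C (q i) = t • q (i + 1))
    (hCd : C (q d) = 0) : ∀ i ≤ d, C (p i) ∈ Q (i + 1) := by
  have hq := (hpq Q hQ).1 hp
  refine (hpq (fun i => (Q (i + 1)).comap C) fun i j hij =>
    Submodule.comap_mono (hQ (Nat.succ_le_succ hij))).2 fun i hi => ?_
  rw [Submodule.mem_comap]
  rcases hi.lt_or_eq with hi | rfl
  · obtain ⟨t, ht⟩ := hC i hi
    rw [ht]
    exact Submodule.smul_mem _ _ (hq (i + 1) hi)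
  · rw [hCd]
    exact zero_mem _

/-- In an LR triple `(A,B,C)`, the map `C` is tridiagonal for the `(A,B)`-decomposition. -/
theorem isTridiagonal_third [FiniteDimensional F V] {d : ℕ} (hdim : Module.finrank F V = d + 1)
    {A B C : Module.End F V} {DAB DBC DCA : LRDecomp F V d}
    (hBC : IsLRPairWith B C DBC) (hCA : IsLRPairWith C A DCA)
    {u₂ w₂ u₃ w₃ : ℕ → V} {α' α'' : ℕ → F}
    (hu₂ : IsLRBasisRev A DCA u₂) (hw₂ : IsLRBasisFor A DAB w₂) (hc₂ : u₂ 0 = w₂ 0)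
    (hα' : IsToeplitzTransition d u₂ w₂ α')
    (hu₃ : IsLRBasisRev B DAB u₃) (hw₃ : IsLRBasisFor B DBC w₃) (hc₃ : u₃ 0 = w₃ 0)
    (hα'' : IsToeplitzTransition d u₃ w₃ α'') : IsTridiagonal C DAB := by
  obtain ⟨c, hc⟩ := exists_isDualFamily hdim DAB id (fun _ h => h) (fun _ _ => rfl) w₂ hw₂.1
  have h0' := toeplitz_zero_eq_one hα' hc₂ (hu₂.1 0 (Nat.zero_le _)).2
  have h0'' := toeplitz_zero_eq_one hα'' hc₃ (hu₃.1 0 (Nat.zero_le _)).2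
  let Q : ℕ → Submodule F V := fun n => ⨅ k, ⨅ _ : n < k, LinearMap.ker (c k)
  let R : ℕ → Submodule F V := fun n => ⨅ k, ⨅ _ : k + n < d, LinearMap.ker (c k)
  have hQmem : ∀ n x, x ∈ Q n ↔ ∀ k, n < k → c k x = 0 := fun n x => by
    simp [Q, Submodule.mem_iInf]
  have hRmem : ∀ n x, x ∈ R n ↔ ∀ k, k + n < d → c k x = 0 := fun n x => by
    simp [R, Submodule.mem_iInf]
  have hQ : Monotone Q := fun i j hij x hx =>
    (hQmem j x).2 fun k hk => (hQmem i x).1 hx k (by omega)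
  have hR : Monotone R := fun i j hij x hx =>
    (hRmem j x).2 fun k hk => (hRmem i x).1 hx k (by omega)
  have hup : ∀ i ≤ d, C (w₂ i) ∈ Q (i + 1) := by
    refine apply_mem_of_shift (q := u₂) hQ
      (fun P hP => (mem_iff_of_isToeplitzTransition hα' h0' hP).symm)
      (fun i hi => (hQmem _ _).2 fun k hk =>
        hc.coord_of_mem k i (by simp; omega) _ (hw₂.1 i hi).1) (fun i hi => ?_) ?_
    · have h1 := Submodule.mem_map_of_mem (f := C) (hu₂.1 i hi.le).1
      have h2 := hCA.1.2 (d - i - 1) (by omega)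
      rw [show d - i - 1 + 1 = d - i by omega] at h2
      rw [h2, show d - i - 1 = d - (i + 1) by omega] at h1
      exact DCA.exists_smul_eq (hu₂.1 (i + 1) hi).1 (hu₂.1 (i + 1) hi).2 h1
    · have h1 := Submodule.mem_map_of_mem (f := C) (hu₂.1 d le_rfl).1
      rwa [Nat.sub_self, hCA.1.1, Submodule.mem_bot] at h1
  have hdown : ∀ i ≤ d, C (u₃ i) ∈ R (i + 1) := by
    refine apply_mem_of_shift (q := w₃) hR
      (fun P hP => mem_iff_of_isToeplitzTransition hα'' h0'' hP)
      (fun i hi => (hRmem _ _).2 fun k hk =>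
        hc.coord_of_mem k (d - i) (by simp; omega) _ (hu₃.1 i hi).1) (fun i hi => ?_) ?_
    · have h1 := Submodule.mem_map_of_mem (f := C) (hw₃.1 i hi.le).1
      rw [hBC.2 i hi.le] at h1
      exact DBC.exists_smul_eq (hw₃.1 (i + 1) hi).1 (hw₃.1 (i + 1) hi).2 h1
    · have h1 := Submodule.mem_map_of_mem (f := C) (hw₃.1 d le_rfl).1
      rwa [hBC.2 d le_rfl, DBC.eq_bot_of_gt _ (Nat.lt_succ_self d), Submodule.mem_bot] at h1
  refine hc.isTridiagonal fun j hj k hk => ?_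
  rcases hk with hk | hk
  · have h1 := hu₃.1 (d - j) (Nat.sub_le _ _)
    rw [show d - (d - j) = j by omega] at h1
    obtain ⟨t, ht⟩ := DAB.exists_smul_eq h1.1 h1.2 (hw₂.1 j hj).1
    rw [ht, map_smul, map_smul,
      (hRmem _ _).1 (hdown (d - j) (Nat.sub_le _ _)) k (by omega), smul_zero]
  · exact (hQmem _ _).1 (hup j hj) k hk

theorem sum_range_eq_three {f : ℕ → F} {N j : ℕ}
    (h : ∀ k < N, k ≠ j → k ≠ j + 1 → k ≠ j + 2 → f k = 0) (hN : ∀ k, N ≤ k → f k = 0) :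
    ∑ k ∈ Finset.range N, f k = f j + f (j + 1) + f (j + 2) := by
  have h1 : ∑ k ∈ Finset.range N, f k = ∑ k ∈ Finset.range (max N (j + 3)), f k :=
    Finset.sum_subset (Finset.range_subset_range.2 (le_max_left _ _)) fun k _ hk =>
      hN k (by simpa using hk)
  have h2 : ∑ k ∈ Finset.Ico j (j + 3), f k = ∑ k ∈ Finset.range (max N (j + 3)), f k := by
    refine Finset.sum_subset (fun k hk => ?_) fun k hk hk' => ?_
    · simp only [Finset.mem_Ico, Finset.mem_range] at hk ⊢
      omega
    · simp only [Finset.mem_Ico] at hk'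
      rcases lt_or_ge k N with hkN | hkN
      · exact h k hkN (by omega) (by omega) (by omega)
      · exact hN k hkN
  rw [h1, ← h2, Finset.sum_Ico_eq_sum_range]
  simp [Finset.sum_range_succ]

theorem sum_range_eq_two {f : ℕ → F} {N : ℕ}
    (h : ∀ k < N, k ≠ 0 → k ≠ 1 → f k = 0) (hN : ∀ k, N ≤ k → f k = 0) :
    ∑ k ∈ Finset.range N, f k = f 0 + f 1 := by
  have h2 : f 2 = 0 := by
    rcases lt_or_ge 2 N with hkN | hkN
    · exact h 2 hkN (by omega) (by omega)
    · exact hN 2 hkN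
  rw [sum_range_eq_three (j := 0) (fun k hk h0 h1 _ => h k hk h0 h1) hN]
  simp [h2]

/-- The superdiagonal entries of the matrix of `X` in the basis `v` with dual family `c`. -/
def superDiag (c : ℕ → V →ₗ[F] F) (v : ℕ → V) (X : Module.End F V) (j : ℕ) : F :=
  c (j - 1) (X (v j))

/-- The subdiagonal entries of the matrix of `X` in the basis `v` with dual family `c`,
indexed by rows. -/
def subDiag (c : ℕ → V →ₗ[F] F) (v : ℕ → V) (X : Module.End F V) : ℕ → F
  | 0 => 0
  | k + 1 => c (k + 1) (X (v k))

/-- The scalar relations between two tridiagonal matrices, with superdiagonals `x`, `z`,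
diagonals `e`, `e'` and subdiagonals `y`, `y'`, that are intertwined by the upper triangular
Toeplitz matrix with parameters `α`. -/
structure ToeplitzRel (d : ℕ) (α x e y z e' y' : ℕ → F) : Prop where
  sub_zero : y 0 = 0
  sub_end : y (d + 1) = 0
  sub_eq : ∀ i ≤ d + 1, y' i = y i
  diag : ∀ i ≤ d, e' i + α 1 * y' i = e i + α 1 * y (i + 1)
  super : ∀ i n, i + n + 1 ≤ d →
    α n * z (i + 1) + α (n + 1) * e' i + α (n + 2) * y' i =
      α n * x (i + n + 1) + α (n + 1) * e (i + n + 1) + α (n + 2) * y (i + n + 2)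

theorem toeplitzRel_of_tridiagonal {d : ℕ} {D D' : LRDecomp F V d}
    {v w : ℕ → V} {c γ : ℕ → V →ₗ[F] F} (hv : IsDualFamily D id v c)
    (hw : IsDualFamily D' (fun i => d - i) w γ) {α : ℕ → F}
    (hα : IsToeplitzTransition d w v α) (hα0 : α 0 = 1) {X : Module.End F V}
    (hX : IsTridiagonal X D) (hX' : IsTridiagonal X D') :
    ToeplitzRel d α (superDiag c v X) (fun j => c j (X (v j))) (subDiag c v X)
      (superDiag γ w X) (fun j => γ j (X (w j))) (subDiag γ w X) := by
  have hγw : ∀ i k, i ≤ d → k ≤ d → γ i (w k) = if k = i then 1 else 0 := by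
    intro i k hi hk
    split_ifs with h
    · rw [h, hw.coord_self i hi]
    · exact hw.coord_of_mem i (d - k) (by omega) _ (hw.mem k hk)
  let T : ℕ → ℕ → F := fun i k => if i ≤ k then α (k - i) else 0
  have hT : ∀ i j, i ≤ d → j ≤ d → γ i (v j) = T i j := by
    intro i j hi hj
    rw [hα j hj, map_sum]
    by_cases hij : i ≤ j
    · rw [Finset.sum_eq_single i]
      · simp [T, hij, hγw i i hi hi]
      · intro k hk hki
        rw [map_smul, hγw i k hi ((Nat.le_of_lt_succ (Finset.mem_range.1 hk)).trans hj),
          if_neg hki, smul_zero]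
      · intro h
        simp at h
        omega
    · simp only [T, if_neg hij]
      refine Finset.sum_eq_zero fun k hk => ?_
      have := Finset.mem_range.1 hk
      rw [map_smul, hγw i k hi (by omega), if_neg (by omega), smul_zero]
  have hM : ∀ k j, k ≤ d → j ≤ d → k + 1 ≠ j → k ≠ j → k ≠ j + 1 → c k (X (v j)) = 0 :=
    fun k j hk hj h1 h2 h3 => by
      rcases Nat.eq_zero_or_pos j with rfl | hj0
      · exact hv.coord_eq_zero_of_tridiagonal hX hj (by simpa using h2) h2 h3
      · exact hv.coord_eq_zero_of_tridiagonal hX hj (by simp; omega) h2 h3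
  have hN : ∀ k j, k ≤ d → j ≤ d → k + 1 ≠ j → k ≠ j → k ≠ j + 1 → γ k (X (w j)) = 0 :=
    fun k j hk hj h1 h2 h3 =>
      hw.coord_eq_zero_of_tridiagonal hX' hj (by omega) (by omega) (by omega)
  have hL : ∀ i j, i ≤ d → j ≤ d →
      γ i (X (v j)) = ∑ k ∈ Finset.range (d + 1), T i k * c k (X (v j)) := by
    intro i j hi hj
    rw [hv.coord_sum (γ i) (X (v j))]
    exact Finset.sum_congr rfl fun k hk => by
      rw [hT i k hi (Nat.le_of_lt_succ (Finset.mem_range.1 hk))]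
  have hR : ∀ i j, i ≤ d → j ≤ d →
      γ i (X (v j)) = ∑ k ∈ Finset.range (d + 1), γ i (X (w k)) * T k j := by
    intro i j hi hj
    rw [← LinearMap.comp_apply, hw.coord_sum (γ i ∘ₗ X) (v j)]
    exact Finset.sum_congr rfl fun k hk => by
      rw [hT k j (Nat.le_of_lt_succ (Finset.mem_range.1 hk)) hj, LinearMap.comp_apply]
  have hTlt : ∀ i k, k < i → T i k = 0 := fun i k h => if_neg (by omega)
  have hTadd : ∀ i n, T i (i + n) = α n := fun i n => by simp [T]
  have hcol : ∀ i j, i ≤ d → j ≤ d → γ i (X (v j)) =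
      (if j = 0 then 0 else T i (j - 1) * superDiag c v X j) + T i j * c j (X (v j)) +
        T i (j + 1) * subDiag c v X (j + 1) := by
    intro i j hi hj
    rw [hL i j hi hj]
    have hbig : ∀ k, d + 1 ≤ k → T i k * c k (X (v j)) = 0 := fun k hk => by
      rw [hv.coord_of_gt k hk]; simp
    rcases j with _ | j
    · rw [sum_range_eq_two (fun k hk h0 h1 => by
        rw [hM k 0 (by omega) hj (by omega) h0 (by omega), mul_zero]) hbig]
      simp [subDiag]
    · rw [sum_range_eq_three (j := j) (fun k hk h0 h1 h2 => by
        rw [hM k (j + 1) (by omega) hj (by omega) (by omega) (by omega), mul_zero]) hbig]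
      simp [subDiag, superDiag]
  have hrow : ∀ i j, i ≤ d → j ≤ d → γ i (X (v j)) =
      superDiag γ w X (i + 1) * T (i + 1) j + γ i (X (w i)) * T i j +
        (if i = 0 then 0 else subDiag γ w X i * T (i - 1) j) := by
    intro i j hi hj
    rw [hR i j hi hj]
    have hbig : ∀ k, d + 1 ≤ k → γ i (X (w k)) * T k j = 0 := fun k hk => by
      rw [hTlt k j (by omega), mul_zero]
    rcases i with _ | i
    · rw [sum_range_eq_two (fun k hk h0 h1 => by
        rw [hN 0 k hi (by omega) (by omega) (by omega) (by omega), zero_mul]) hbig]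
      simp [superDiag]
      ring
    · rw [sum_range_eq_three (j := i) (fun k hk h0 h1 h2 => by
        rw [hN (i + 1) k hi (by omega) (by omega) (by omega) (by omega), zero_mul]) hbig]
      simp [subDiag, superDiag]
      ring
  have hrow' : ∀ i n, i + n ≤ d → γ i (X (v (i + n))) =
      superDiag γ w X (i + 1) * T (i + 1) (i + n) + γ i (X (w i)) * α n +
        subDiag γ w X i * α (n + 1) := by
    intro i n hin
    rw [hrow i (i + n) (by omega) hin, hTadd]
    rcases i with _ | i
    · simp [subDiag]
    · rw [if_neg (by omega), Nat.add_sub_cancel, show i + 1 + n = i + (n + 1) by omega, hTadd]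
  refine ⟨rfl, ?_, fun i hi => ?_, fun i hi => ?_, fun i n hin => ?_⟩
  · simp [subDiag, hv.coord_of_gt (d + 1) (Nat.lt_succ_self d)]
  · rcases i with _ | i
    · rfl
    · rcases (Nat.le_of_succ_le_succ hi).lt_or_eq with hi | rfl
      · have h1 := hcol (i + 1) i hi hi.le
        have h2 := hrow (i + 1) i hi hi.le
        rw [hTlt (i + 1) (i - 1) (by omega), hTlt (i + 1) i (by omega),
          show T (i + 1) (i + 1) = α 0 from hTadd (i + 1) 0, hα0] at h1
        rw [hTlt (i + 1 + 1) i (by omega), hTlt (i + 1) i (by omega), if_neg (by omega),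
          Nat.add_sub_cancel, show T i i = α 0 from hTadd i 0, hα0] at h2
        simp only [zero_mul, ite_self, mul_one, one_mul, mul_zero, zero_add] at h1 h2
        rw [← h1, ← h2]
      · simp [subDiag, hv.coord_of_gt (i + 1) (Nat.lt_succ_self i),
          hw.coord_of_gt (i + 1) (Nat.lt_succ_self i)]
  · have h1 := hcol i i hi hi
    have h2 := hrow' i 0 hi
    rw [show T i i = α 0 from hTadd i 0, hTadd, hα0] at h1
    rw [Nat.add_zero, hTlt (i + 1) i (by omega), hα0] at h2
    have h3 : (if i = 0 then 0 else T i (i - 1) * superDiag c v X i) = 0 := by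
      split_ifs with h
      · rfl
      · rw [hTlt i (i - 1) (by omega), zero_mul]
    rw [h3] at h1
    linear_combination h1 - h2
  · have h1 := hcol i (i + n + 1) (by omega) hin
    have h2 := hrow' i (n + 1) hin
    rw [if_neg (by omega), Nat.add_sub_cancel, hTadd,
      show i + n + 1 = i + (n + 1) by omega, hTadd,
      show i + (n + 1) + 1 = i + (n + 2) by omega, hTadd] at h1
    rw [show i + (n + 1) = i + 1 + n by omega, hTadd] at h2
    rw [show i + (n + 1) = i + 1 + n by omega] at h1
    rw [show i + n + 1 = i + 1 + n by omega, show i + n + 2 = i + (n + 2) by omega]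
    linear_combination h1 - h2

/-- The Toeplitz parameters of a bipartite triple are constrained by the relations of a
matrix with zero diagonals, lower bidiagonal in the second basis. -/
theorem ToeplitzRel.odd_params_eq_zero {d : ℕ} (hd : 4 ≤ d) {α x e y z e' y' : ℕ → F}
    (h : ToeplitzRel d α x e y z e' y') (he : ∀ i ≤ d, e i = 0) (he' : ∀ i ≤ d, e' i = 0)
    (hz : ∀ i, 1 ≤ i → i ≤ d → z i = 0) (hy : ∀ i, 1 ≤ i → i ≤ d → y i ≠ 0) :
    α 1 = 0 ∧ α 3 = 0 := by
  have hy0 : y' 0 = 0 := by rw [h.sub_eq 0 (by omega), h.sub_zero]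
  have h1 : α 1 = 0 := by
    have := h.diag 0 (by omega)
    rw [he 0 (by omega), he' 0 (by omega), hy0] at this
    simpa [hy 1 le_rfl (by omega)] using this.symm
  refine ⟨h1, ?_⟩
  have := h.super 0 1 (by omega)
  simp only [Nat.zero_add, Nat.reduceAdd] at this
  rw [hz 1 le_rfl (by omega), he' 0 (by omega), he 2 (by omega), h1, hy0] at this
  simpa [hy 3 (by omega) (by omega)] using this.symm

/-- The scalar relations when the odd Toeplitz parameters and the diagonals vanish. -/
structure BipartiteRel (d : ℕ) (a b : F) (x y z : ℕ → F) : Prop where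
  sub_zero : y 0 = 0
  sub_end : y (d + 1) = 0
  super_one : ∀ i, i + 1 ≤ d → z (i + 1) + y i = x (i + 1) + y (i + 2)
  super_three : ∀ i, i + 3 ≤ d → z (i + 1) + a * y i = x (i + 3) + a * y (i + 4)
  super_five : ∀ i, i + 5 ≤ d → a * z (i + 1) + b * y i = a * x (i + 5) + b * y (i + 6)

theorem ToeplitzRel.diag_eq {d : ℕ} {α x e y z e' y' : ℕ → F}
    (h : ToeplitzRel d α x e y z e' y') (h1 : α 1 = 0) {i : ℕ} (hi : i ≤ d) : e' i = e i := by
  simpa [h1] using h.diag i hi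

theorem ToeplitzRel.diag_add_two {d : ℕ} {α x e y z e' y' : ℕ → F}
    (h : ToeplitzRel d α x e y z e' y') (h1 : α 1 = 0) (h2 : α 2 = 1) (h3 : α 3 = 0) {i : ℕ}
    (hi : i + 2 ≤ d) : e (i + 2) = e i := by
  have := h.super i 1 hi
  simp only [Nat.reduceAdd, h1, h2, h3] at this
  rw [h.diag_eq h1 (by omega)] at this
  simpa using this.symm

theorem ToeplitzRel.diag_eq_zero {d : ℕ} {α x e y z e' y' : ℕ → F}
    (h : ToeplitzRel d α x e y z e' y') (h1 : α 1 = 0) (h2 : α 2 = 1) (h3 : α 3 = 0)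
    (he0 : e 0 = 0) (he1 : e 1 = 0) : ∀ i ≤ d, e i = 0 := by
  intro i
  induction i using Nat.twoStepInduction with
  | zero => exact fun _ => he0
  | one => exact fun _ => he1
  | more i ih _ => exact fun hi => by rw [h.diag_add_two h1 h2 h3 hi, ih (by omega)]

theorem ToeplitzRel.bipartiteRel {d : ℕ} {α x e y z e' y' : ℕ → F}
    (h : ToeplitzRel d α x e y z e' y') (h0 : α 0 = 1) (h1 : α 1 = 0) (h2 : α 2 = 1)
    (h3 : α 3 = 0) (he : ∀ i ≤ d, e i = 0) : BipartiteRel d (α 4) (α 6) x y z := by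
  have he' : ∀ i ≤ d, e' i = 0 := fun i hi => by rw [h.diag_eq h1 hi, he i hi]
  refine ⟨h.sub_zero, h.sub_end, fun i hi => ?_, fun i hi => ?_, fun i hi => ?_⟩
  · have := h.super i 0 hi
    simpa [h0, h1, h2, h.sub_eq i (by omega)] using this
  · have := h.super i 2 hi
    simpa [h2, h3, h.sub_eq i (by omega)] using this
  · have := h.super i 4 hi
    rw [he' i (by omega), he (i + 4 + 1) hi, h.sub_eq i (by omega)] at this
    simpa using this

theorem sq_ne_of_bipartiteRel {d : ℕ} (hd : 5 ≤ d) {a b : F} {x y z x' y' z' : ℕ → F}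
    (h : BipartiteRel d a b x y z) (hx : ∀ i, 1 ≤ i → i ≤ d → x i = 0)
    (hy : ∀ i, 1 ≤ i → i ≤ d → y i ≠ 0)
    (h' : BipartiteRel d a b x' y' z') (hz' : ∀ i, 1 ≤ i → i ≤ d → z' i = 0)
    (hy' : ∀ i, 1 ≤ i → i ≤ d → y' i ≠ 0) : b ≠ a ^ 2 := by
  obtain ⟨n, rfl⟩ := Nat.exists_eq_add_of_le' hd
  have ha : a ≠ 0 := by
    rintro rfl
    have h1 := h'.super_three (n + 2) (by omega)
    have h2 := h'.super_one (n + 4) (by omega)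
    simp only [Nat.add_assoc, Nat.reduceAdd] at h1 h2
    rw [hz' _ (by omega) (by omega)] at h1 h2
    have h3 := h'.sub_end
    simp only [Nat.add_assoc, Nat.reduceAdd] at h3
    exact hy' (n + 4) (by omega) (by omega) (by linear_combination h2 - h1 + h3)
  rintro rfl
  have h1 := h.super_three n (by omega)
  have h2 := h.super_five n (by omega)
  rw [hx _ (by omega) (by omega)] at h1 h2
  have h3 := h.sub_end
  simp only [Nat.add_assoc, Nat.reduceAdd] at h3
  have h4 : a ^ 2 * y (n + 4) = 0 := by linear_combination h2 - a * h1 + a ^ 2 * h3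
  exact hy (n + 4) (by omega) (by omega) (by simpa [ha] using h4)

namespace BipartiteRel

variable {d : ℕ} {a b : F} {x y z : ℕ → F}

theorem four_term (h : BipartiteRel d a b x y z) {i : ℕ} (hi : i + 5 ≤ d) :
    (b - a ^ 2) * (y i - y (i + 6)) = (a ^ 2 - a) * (y (i + 2) - y (i + 4)) := by
  have h1 := h.super_one (i + 2) (by omega)
  have h2 := h.super_three i (by omega)
  have h3 := h.super_three (i + 2) (by omega)
  have h4 := h.super_five i hi
  simp only [Nat.add_assoc, Nat.reduceAdd] at h1 h2 h3
  linear_combination h4 - a * h2 - a * h3 + a * h1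

theorem even_sub_eq_zero (h : BipartiteRel d a b x y z) (hab : 5 ≤ d → b ≠ a ^ 2)
    (h2 : y 2 = 0) (h4 : y 4 = 0) : ∀ k, 2 * k ≤ d + 1 → y (2 * k) = 0 := by
  intro k
  induction k using Nat.strong_induction_on with
  | _ k ih =>
    intro hk
    match k, ih, hk with
    | 0, _, _ => exact h.sub_zero
    | 1, _, _ => exact h2
    | 2, _, _ => exact h4
    | k + 3, ih, hk =>
      have h5 := h.four_term (i := 2 * k) (by omega)
      have e0 := ih k (by omega) (by omega)
      have e1 := ih (k + 1) (by omega) (by omega)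
      have e2 := ih (k + 2) (by omega) (by omega)
      rw [show 2 * (k + 1) = 2 * k + 2 by omega] at e1
      rw [show 2 * (k + 2) = 2 * k + 4 by omega] at e2
      rw [e0, e1, e2] at h5
      simpa [sub_ne_zero.2 (hab (by omega)), mul_add] using h5

theorem sub_eq_zero_of_end (h : BipartiteRel d a b x y z) (hab : 5 ≤ d → b ≠ a ^ 2) {n : ℕ}
    (hn : n + 3 = d) (h1 : y n = 0) (h2 : y (n + 2) = 0) :
    ∀ k i, i + 2 * k = d + 1 → y i = 0 := by
  intro k
  induction k using Nat.strong_induction_on with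
  | _ k ih =>
    intro i hk
    match k, ih, hk with
    | 0, _, hk => rw [show i = d + 1 by omega]; exact h.sub_end
    | 1, _, hk => rwa [show i = n + 2 by omega]
    | 2, _, hk => rwa [show i = n by omega]
    | k + 3, ih, hk =>
      have h5 := h.four_term (i := i) (by omega)
      rw [ih k (by omega) (i + 6) (by omega), ih (k + 1) (by omega) (i + 4) (by omega),
        ih (k + 2) (by omega) (i + 2) (by omega)] at h5
      simpa [sub_ne_zero.2 (hab (by omega))] using h5

theorem super_eq_zero (h : BipartiteRel d a b x y z) (hy : ∀ i ≤ d + 1, y i = 0)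
    (h1 : z 1 = 0) (h2 : z 2 = 0) : ∀ i, 1 ≤ i → i ≤ d → x i = 0 := by
  have hxz : ∀ i, i + 1 ≤ d → z (i + 1) = x (i + 1) := fun i hi => by
    simpa [hy i (by omega), hy (i + 2) (by omega)] using h.super_one i hi
  have hx : ∀ i, i + 1 ≤ d → x (i + 1) = 0 := by
    intro i
    induction i using Nat.twoStepInduction with
    | zero => exact fun hi => by rw [← hxz 0 hi, h1]
    | one => exact fun hi => by rw [← hxz 1 hi, h2]
    | more i ih _ =>
      intro hi
      have h3 := h.super_three i hi
      rw [hxz i (by omega), ih (by omega), hy i (by omega), hy (i + 4) (by omega)] at h3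
      simpa using h3.symm
  intro i hi hid
  obtain ⟨j, rfl⟩ := Nat.exists_eq_add_of_le' hi
  exact hx j hid

end BipartiteRel

theorem Lowers.apply_zero {d : ℕ} {A : Module.End F V} {D : LRDecomp F V d} (h : Lowers A D)
    {v : V} (hv : v ∈ D.sub 0) : A v = 0 := by
  have := Submodule.mem_map_of_mem (f := A) hv
  rwa [h.1, Submodule.mem_bot] at this

theorem Lowers.apply_mem {d : ℕ} {A : Module.End F V} {D : LRDecomp F V d} (h : Lowers A D)
    {i : ℕ} (hi : i < d) {v : V} (hv : v ∈ D.sub (i + 1)) : A v ∈ D.sub i := by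
  rw [← h.2 i hi]
  exact Submodule.mem_map_of_mem hv

theorem Raises.apply_mem {d : ℕ} {B : Module.End F V} {D : LRDecomp F V d} (h : Raises B D)
    {i : ℕ} {v : V} (hv : v ∈ D.sub i) : B v ∈ D.sub (i + 1) := by
  rcases le_or_gt i d with hi | hi
  · rw [← h i hi]
    exact Submodule.mem_map_of_mem hv
  · rw [D.eq_bot_of_gt i hi, Submodule.mem_bot] at hv
    rw [hv, map_zero]
    exact zero_mem _

theorem apply_ne_zero_of_map_eq {d : ℕ} {A : Module.End F V} {D : LRDecomp F V d} {i j : ℕ}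
    (hj : j ≤ d) (h : Submodule.map A (D.sub i) = D.sub j) {v : V} (hv : v ∈ D.sub i)
    (hv0 : v ≠ 0) : A v ≠ 0 := by
  intro h0
  have hbot : D.sub j = ⊥ := by
    rw [← h, eq_bot_iff]
    rintro _ ⟨x, hx, rfl⟩
    obtain ⟨t, rfl⟩ := D.exists_smul_eq hv hv0 hx
    simp [h0]
  have h1 := D.finrank_eq_one j hj
  rw [hbot, finrank_bot] at h1
  exact zero_ne_one h1

theorem Raises.isTridiagonal {d : ℕ} {B : Module.End F V} {D : LRDecomp F V d}
    (h : Raises B D) : IsTridiagonal B D :=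
  fun _ _ hv => Submodule.mem_sup_right (h.apply_mem hv)

theorem Lowers.isTridiagonal {d : ℕ} {A : Module.End F V} {D : LRDecomp F V d}
    (h : Lowers A D) : IsTridiagonal A D := by
  intro i v hv
  rcases i with _ | i
  · rw [h.apply_zero hv]
    exact zero_mem _
  · rcases lt_or_ge i d with hi | hi
    · exact Submodule.mem_sup_left (Submodule.mem_sup_left (h.apply_mem hi hv))
    · rw [D.eq_bot_of_gt (i + 1) (by omega), Submodule.mem_bot] at hv
      rw [hv, map_zero]
      exact zero_mem _

/-- If `C` has zero diagonal and is tridiagonal in the basis `v`, then the vectors obtained from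
`v 0` by repeatedly applying `C` only involve basis vectors of one parity. -/
theorem coord_eq_zero_of_parity {d : ℕ} {D : LRDecomp F V d} {v w : ℕ → V}
    {c : ℕ → V →ₗ[F] F} (hv : IsDualFamily D id v c) {C : Module.End F V}
    (hC : IsTridiagonal C D) (hdiag : ∀ i ≤ d, c i (C (v i)) = 0) (hw0 : w 0 = v 0)
    (hw : ∀ i < d, ∃ t : F, w (i + 1) = t • C (w i)) :
    ∀ k ≤ d, ∀ l ≤ d, l % 2 ≠ k % 2 → c l (w k) = 0 := by
  intro k
  induction k with
  | zero =>
    intro _ l _ hl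
    rw [hw0]
    exact hv.coord_of_mem l 0 (by rintro h; simp at h; omega) _ (hv.mem 0 (Nat.zero_le _))
  | succ k ih =>
    intro hk l hl hlk
    obtain ⟨t, ht⟩ := hw k hk
    rw [ht, map_smul, ← LinearMap.comp_apply, hv.coord_sum (c l ∘ₗ C), Finset.sum_eq_zero,
      smul_zero]
    intro m hm
    have hmd := Nat.le_of_lt_succ (Finset.mem_range.1 hm)
    by_cases hmk : m % 2 = k % 2
    · rw [LinearMap.comp_apply]
      by_cases hml : l = m
      · rw [hml, hdiag m hmd, zero_mul]
      · rw [hv.coord_eq_zero_of_tridiagonal hC hmd (by simp; omega) hml (by simp; omega),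
          zero_mul]
    · rw [ih (by omega) m hmd hmk, mul_zero]

theorem stmt17
    {F : Type*} [Field F] {V : Type*} [AddCommGroup V] [Module F V]
    [FiniteDimensional F V] {d : ℕ} (hdim : Module.finrank F V = d + 1)
    (A B C : Module.End F V) (DAB DBC DCA : LRDecomp F V d)
    (hAB : IsLRPairWith A B DAB) (hBC : IsLRPairWith B C DBC) (hCA : IsLRPairWith C A DCA)
    (hd : 4 ≤ d)
    (E E' E'' : ℕ → Module.End F V)
    (hE : IsIdemSeq DAB E) (hE' : IsIdemSeq DBC E') (hE'' : IsIdemSeq DCA E'')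
    (hbip : IsBipartite d A B C E E' E'')
    (u₁ w₁ u₂ w₂ u₃ w₃ : ℕ → V) (α α' α'' : ℕ → F)
    (hu₁ : IsLRBasisRev C DBC u₁) (hw₁ : IsLRBasisFor C DCA w₁) (hc₁ : u₁ 0 = w₁ 0)
    (hα : IsToeplitzTransition d u₁ w₁ α)
    (hu₂ : IsLRBasisRev A DCA u₂) (hw₂ : IsLRBasisFor A DAB w₂) (hc₂ : u₂ 0 = w₂ 0)
    (hα' : IsToeplitzTransition d u₂ w₂ α')
    (hu₃ : IsLRBasisRev B DAB u₃) (hw₃ : IsLRBasisFor B DBC w₃) (hc₃ : u₃ 0 = w₃ 0)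
    (hα'' : IsToeplitzTransition d u₃ w₃ α'')
    (hnorm : α 2 = 1 ∧ α' 2 = 1 ∧ α'' 2 = 1) :
    Module.finrank F (tridiagSpace DAB DBC DCA) ≤ 8 := by
  obtain ⟨c, hc⟩ := exists_isDualFamily hdim DAB id (fun _ h => h) (fun _ _ => rfl) w₂ hw₂.1
  obtain ⟨γ, hγ⟩ := exists_isDualFamily hdim DCA (fun i => d - i) (fun _ _ => Nat.sub_le _ _)
    (fun i hi => by omega) u₂ hu₂.1
  have h0' := toeplitz_zero_eq_one hα' hc₂ (hu₂.1 0 (Nat.zero_le _)).2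
  have h0'' := toeplitz_zero_eq_one hα'' hc₃ (hu₃.1 0 (Nat.zero_le _)).2
  have hCtri : IsTridiagonal C DAB :=
    isTridiagonal_third hdim hBC hCA hu₂ hw₂ hc₂ hα' hu₃ hw₃ hc₃ hα''
  have hBtri : IsTridiagonal B DCA :=
    isTridiagonal_third hdim hAB hBC hu₁ hw₁ hc₁ hα hu₂ hw₂ hc₂ hα'
  have hCu : ∀ i < d, C (u₂ i) ∈ DCA.sub (d - (i + 1)) ∧ C (u₂ i) ≠ 0 := by
    intro i hi
    have h1 := hu₂.1 i hi.le
    rw [show d - i = d - (i + 1) + 1 by omega] at h1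
    exact ⟨hCA.1.apply_mem (by omega) h1.1,
      apply_ne_zero_of_map_eq (Nat.sub_le _ _) (hCA.1.2 (d - (i + 1)) (by omega)) h1.1 h1.2⟩
  have hCud : C (u₂ d) = 0 :=
    hCA.1.apply_zero (by simpa using (hu₂.1 d le_rfl).1)
  have hBw : ∀ i < d, B (w₂ i) ∈ DAB.sub (i + 1) ∧ B (w₂ i) ≠ 0 := fun i hi =>
    ⟨hAB.2.apply_mem (hw₂.1 i hi.le).1,
      apply_ne_zero_of_map_eq hi (hAB.2 i hi.le) (hw₂.1 i hi.le).1 (hw₂.1 i hi.le).2⟩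
  have hCrel := toeplitzRel_of_tridiagonal hc hγ hα' h0' hCtri hCA.1.isTridiagonal
  have hBrel := toeplitzRel_of_tridiagonal hc hγ hα' h0' hAB.2.isTridiagonal hBtri
  have hCe : ∀ i ≤ d, c i (C (w₂ i)) = 0 := fun i hi => by
    rw [← hc.trace_mul_idem hE C hi]
    exact (hbip i hi).1
  have hCγ : ∀ i ≤ d, ∀ k ≤ d, k ≠ i + 1 → γ k (C (u₂ i)) = 0 := by
    intro i hi k hk hki
    rcases hi.lt_or_eq with hi | rfl
    · exact hγ.coord_of_mem k (d - (i + 1)) (by omega) _ (hCu i hi).1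
    · rw [hCud, map_zero]
  have hCz : ∀ i, 1 ≤ i → i ≤ d → superDiag γ u₂ C i = 0 := fun i h1 hi =>
    hCγ i hi (i - 1) (by omega) (by omega)
  have hCy : ∀ i, 1 ≤ i → i ≤ d → subDiag c w₂ C i ≠ 0 := by
    intro i h1 hi
    rw [← hCrel.sub_eq i (by omega)]
    obtain ⟨j, rfl⟩ := Nat.exists_eq_add_of_le' h1
    exact hγ.coord_ne_zero hi (hCu j hi).1 (hCu j hi).2
  have hBc : ∀ i ≤ d, ∀ k, k ≠ i + 1 → c k (B (w₂ i)) = 0 := fun i hi k hki =>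
    hc.coord_of_mem k (i + 1) (Ne.symm hki) _ (hAB.2.apply_mem (hw₂.1 i hi).1)
  have hBx : ∀ i, 1 ≤ i → i ≤ d → superDiag c w₂ B i = 0 := fun i h1 hi =>
    hBc i hi (i - 1) (by omega)
  have hBy : ∀ i, 1 ≤ i → i ≤ d → subDiag c w₂ B i ≠ 0 := by
    intro i h1 hi
    obtain ⟨j, rfl⟩ := Nat.exists_eq_add_of_le' h1
    exact hc.coord_ne_zero hi (hBw j hi).1 (hBw j hi).2
  obtain ⟨h1, h3⟩ := hCrel.odd_params_eq_zero hd hCe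
    (fun i hi => hCγ i hi i hi (by omega)) hCz hCy
  have h2 := hnorm.2.1
  have hab : 5 ≤ d → α' 6 ≠ α' 4 ^ 2 := fun h5 =>
    sq_ne_of_bipartiteRel h5
      (hBrel.bipartiteRel h0' h1 h2 h3 fun i hi => hBc i hi i (by omega)) hBx hBy
      (hCrel.bipartiteRel h0' h1 h2 h3 hCe) hCz hCy
  have heven : d % 2 = 0 := by
    by_contra hodd
    have hpar : c 0 (u₂ d) = 0 := by
      refine coord_eq_zero_of_parity hc hCtri hCe hc₂ (fun i hi => ?_) d le_rfl 0
        (Nat.zero_le _) (by omega)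
      exact DCA.exists_smul_eq (hCu i hi).1 (hCu i hi).2 (hu₂.1 (i + 1) hi).1
    have hud : u₂ d ∈ DCA.sub 0 := by simpa using (hu₂.1 d le_rfl).1
    obtain ⟨s, hs⟩ := DCA.exists_smul_eq hud (hu₂.1 d le_rfl).2 (hw₁.1 0 (Nat.zero_le _)).1
    obtain ⟨t, ht⟩ := DBC.exists_smul_eq (hu₁.1 0 (Nat.zero_le _)).1
      (hu₁.1 0 (Nat.zero_le _)).2 (by simpa using (hw₃.1 d le_rfl).1)
    have hz : c 0 (w₃ d) = 0 := by
      rw [ht, hc₁, hs, map_smul, map_smul, hpar, smul_zero, smul_zero]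
    rw [hα'' d le_rfl, map_sum, Finset.sum_eq_single d] at hz
    · rw [Nat.sub_self, h0'', one_smul] at hz
      exact hc.coord_ne_zero (Nat.zero_le _) (by simpa using (hu₃.1 d le_rfl).1)
        (hu₃.1 d le_rfl).2 hz
    · intro k hk hkd
      have := Finset.mem_range.1 hk
      rw [map_smul, hc.coord_of_mem 0 (d - k) (by simp; omega) _ (hu₃.1 k (by omega)).1,
        smul_zero]
    · intro h
      simp at h
  obtain ⟨m, rfl⟩ := Nat.exists_eq_add_of_le' hd
  let ent : (V →ₗ[F] F) → V → Module.End F V →ₗ[F] F := fun f x => f ∘ₗ LinearMap.applyₗ x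
  let Φ : Module.End F V →ₗ[F] (Fin 8 → F) := LinearMap.pi
    ![ent (c 0) (w₂ 0), ent (c 1) (w₂ 1), ent (c 2) (w₂ 1), ent (c 4) (w₂ 3),
      ent (c (m + 1)) (w₂ m), ent (c (m + 3)) (w₂ (m + 2)),
      ent (γ 0) (u₂ 1), ent (γ 1) (u₂ 2)]
  have hinj : Function.Injective (Φ ∘ₗ (tridiagSpace DAB DBC DCA).subtype) := by
    rw [← LinearMap.ker_eq_bot, LinearMap.ker_eq_bot']
    rintro ⟨X, hX⟩ hΦ
    have hΦ' : ∀ i, Φ X i = 0 := fun i => congrFun hΦ i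
    have hrel := toeplitzRel_of_tridiagonal hc hγ hα' h0' hX.1 hX.2.2
    have he := hrel.diag_eq_zero h1 h2 h3 (hΦ' 0) (hΦ' 1)
    have hbr := hrel.bipartiteRel h0' h1 h2 h3 he
    have hy : ∀ i ≤ m + 4 + 1, subDiag c w₂ X i = 0 := by
      intro i hi
      rcases Nat.mod_two_eq_zero_or_one i with hi2 | hi2
      · rw [show i = 2 * (i / 2) by omega]
        exact hbr.even_sub_eq_zero hab (hΦ' 2) (hΦ' 3) (i / 2) (by omega)
      · exact hbr.sub_eq_zero_of_end hab (n := m + 1) rfl (hΦ' 4) (hΦ' 5)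
          ((m + 5 - i) / 2) i (by omega)
    have hx := hbr.super_eq_zero hy (hΦ' 6) (hΦ' 7)
    refine Subtype.ext (hc.ext_end fun j hj => hc.eq_zero fun k hk => ?_)
    by_cases hkj : k + 1 = j ∨ k = j ∨ k = j + 1
    · rcases hkj with rfl | rfl | rfl
      · exact hx (k + 1) (by omega) hj
      · exact he k hj
      · exact hy (j + 1) (by omega)
    · rcases Nat.eq_zero_or_pos j with rfl | hj0
      · exact hc.coord_eq_zero_of_tridiagonal hX.1 hj (by simp; omega) (by simp; omega)
          (by simp; omega)
      · exact hc.coord_eq_zero_of_tridiagonal hX.1 hj (by simp; omega) (by simp; omega)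
          (by simp; omega)
  simpa using LinearMap.finrank_le_finrank_of_injective hinj
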